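/- arXiv:1308.1039 — 9 statements merged into one kernel-verified Lean document; each statement's English description precedes it below -/
import Mathlib

section
/- Let C be a class of groups (closed under isomorphism) that is closed under taking subgroups. Then the following three statements are equivalent: (1) C satisfies the Gruenberg condition (and hence is a root class); (2) C is closed under complete (Cartesian) wreath products, i.e., for all groups X, Y in C the complete wreath product X Wr Y belongs to C; (3) C is closed under extensions and, for any two groups X, Y in C, contains the unrestricted Cartesian product ∏_{y ∈ Y} X_y, where each X_y is an isomorphic copy of X. -/
universe u

/-- A class of groups `C` is closed under isomorphism. -/
def IsoClosed (C : ∀ (G : Type u) [Group G], Prop) : Prop :=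
  ∀ (G H : Type u) [Group G] [Group H], (G ≃* H) → C G → C H

/-- A class of groups `C` is closed under taking subgroups. -/
def SubgroupClosed (C : ∀ (G : Type u) [Group G], Prop) : Prop :=
  ∀ (G : Type u) [Group G] (H : Subgroup G), C G → C H

/-- A class of groups `C` is closed under extensions. -/
def ExtensionClosed (C : ∀ (G : Type u) [Group G], Prop) : Prop :=
  ∀ (G : Type u) [Group G] (N : Subgroup G) [N.Normal], C N → C (G ⧸ N) → C G

/-- A class of groups `C` is closed under direct products of two of its members. -/
def ProdClosed (C : ∀ (G : Type u) [Group G], Prop) : Prop :=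
  ∀ (X Y : Type u) [Group X] [Group Y], C X → C Y → C (X × Y)

/-- For all `X, Y ∈ C`, the unrestricted Cartesian product `∏_{y ∈ Y} X` belongs to `C`. -/
def PiClosed (C : ∀ (G : Type u) [Group G], Prop) : Prop :=
  ∀ (X Y : Type u) [Group X] [Group Y], C X → C Y → C (Y → X)

/-- The Gruenberg condition: for every group `X` and every subnormal chain `Z ⊴ Y ⊴ X`
with factors `Y/Z` and `X/Y` in `C`, there is a normal subgroup `T` of `X` with `T ≤ Z`
and `X/T ∈ C`. -/
def Gruenberg (C : ∀ (G : Type u) [Group G], Prop) : Prop :=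
  ∀ (X : Type u) [Group X] (Y : Subgroup X) [Y.Normal] (Z : Subgroup X)
    [(Z.subgroupOf Y).Normal], Z ≤ Y →
    C (Y ⧸ Z.subgroupOf Y) → C (X ⧸ Y) →
    ∃ (T : Subgroup X) (hT : T.Normal), T ≤ Z ∧ (letI := hT; C (X ⧸ T))

/-- A root class of groups. -/
def RootClass (C : ∀ (G : Type u) [Group G], Prop) : Prop :=
  IsoClosed C ∧ SubgroupClosed C ∧ ProdClosed C ∧ Gruenberg C

/-- The action of `Y` on the unrestricted direct power `Y → X` by translating coordinates. -/
def wreathAut (X Y : Type u) [Group X] [Group Y] : Y →* MulAut (Y → X) where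
  toFun g :=
    { toFun := fun b y => b (g⁻¹ * y)
      invFun := fun b y => b (g * y)
      left_inv := fun b => funext fun y => by simp [← mul_assoc]
      right_inv := fun b => funext fun y => by simp [← mul_assoc]
      map_mul' := fun b₁ b₂ => rfl }
  map_one' := by ext b y; simp
  map_mul' := fun g₁ g₂ => by ext b y; simp [mul_assoc]

/-- The complete (Cartesian) wreath product `X Wr Y`: the semidirect product of the
unrestricted direct power `Y → X` by `Y` acting by translation of coordinates. -/
abbrev WreathProduct (X Y : Type u) [Group X] [Group Y] : Type u :=
  SemidirectProduct (Y → X) Y (wreathAut X Y)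

/-- A class of groups `C` is closed under complete (Cartesian) wreath products. -/
def WreathClosed (C : ∀ (G : Type u) [Group G], Prop) : Prop :=
  ∀ (X Y : Type u) [Group X] [Group Y], C X → C Y → C (WreathProduct X Y)

theorem C_of_inj {C : ∀ (G : Type u) [Group G], Prop}
    (hiso : IsoClosed C) (hsub : SubgroupClosed C) {G H : Type u} [Group G] [Group H]
    (f : G →* H) (hf : Function.Injective f) (h : C H) : C G :=
  hiso _ _ (MonoidHom.ofInjective hf).symm (hsub H f.range h)

/-- Kaloujnine-Krasner cocycle. -/
def kkFun {G : Type u} [Group G] (N : Subgroup G) [N.Normal] (s : G ⧸ N → G)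
    (hs : ∀ c, (QuotientGroup.mk (s c) : G ⧸ N) = c) (g : G) (c : G ⧸ N) : N :=
  ⟨(s c)⁻¹ * g * s ((g : G ⧸ N)⁻¹ * c), by
    rw [← QuotientGroup.eq_one_iff]
    simp [hs]⟩

/-- Kaloujnine-Krasner homomorphism. -/
def kkHom {G : Type u} [Group G] (N : Subgroup G) [N.Normal] (K : Subgroup N) [K.Normal]
    (s : G ⧸ N → G) (hs : ∀ c, (QuotientGroup.mk (s c) : G ⧸ N) = c) :
    G →* WreathProduct (N ⧸ K) (G ⧸ N) :=
  MonoidHom.mk' (fun g => ⟨fun c => (kkFun N s hs g c : N ⧸ K), (g : G ⧸ N)⟩) (by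
    intro a b
    refine SemidirectProduct.ext ?_ ?_
    · funext c
      change ((kkFun N s hs (a * b) c : N) : N ⧸ K) =
        (kkFun N s hs a c : N ⧸ K) * (kkFun N s hs b ((a : G ⧸ N)⁻¹ * c) : N ⧸ K)
      rw [← QuotientGroup.mk_mul]
      congr 1
      apply Subtype.ext
      simp [kkFun, mul_assoc]
    · rfl)

theorem gruenberg_of_wreath {C : ∀ (G : Type u) [Group G], Prop}
    (hiso : IsoClosed C) (hsub : SubgroupClosed C) (hw : WreathClosed C) : Gruenberg C := by
  intro X _ Y _ Z _ hZY h1 h2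
  classical
  let s : X ⧸ Y → X := Function.update Quotient.out 1 1
  have hs1 : s 1 = 1 := by simp [s]
  have hs : ∀ c, (QuotientGroup.mk (s c) : X ⧸ Y) = c := by
    intro c
    by_cases hc : c = 1
    · subst hc; rw [hs1]; rfl
    · simp [s, hc]
  let f := kkHom Y (Z.subgroupOf Y) s hs
  refine ⟨f.ker, inferInstance, ?_, ?_⟩
  · intro g hg
    have hg' : f g = 1 := hg
    have hr : (g : X ⧸ Y) = 1 := congrArg SemidirectProduct.right hg'
    have hl : ((kkFun Y s hs g 1 : Y) : Y ⧸ Z.subgroupOf Y) = 1 :=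
      congrFun (congrArg SemidirectProduct.left hg') 1
    rw [QuotientGroup.eq_one_iff, Subgroup.mem_subgroupOf] at hl
    simpa [kkFun, hr, hs1] using hl
  · exact C_of_inj hiso hsub (QuotientGroup.kerLift f) (QuotientGroup.kerLift_injective f)
      (hw _ _ h1 h2)

theorem ext_of_gruenberg {C : ∀ (G : Type u) [Group G], Prop}
    (hiso : IsoClosed C) (hg : Gruenberg C) : ExtensionClosed C := by
  intro G _ N _ hN hQ
  have e : (⊥ : Subgroup G).subgroupOf N = ⊥ := by simp
  have : ((⊥ : Subgroup G).subgroupOf N).Normal := by rw [e]; infer_instance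
  obtain ⟨T, hT, hle, hC⟩ := hg G N ⊥ bot_le
    (hiso _ _ ((QuotientGroup.quotientMulEquivOfEq e).trans QuotientGroup.quotientBot).symm hN) hQ
  have hT' : T = ⊥ := le_bot_iff.1 hle
  subst hT'
  exact hiso _ _ QuotientGroup.quotientBot hC

/-- The quotient of the wreath product by the base. -/
noncomputable def wrQuot (X Y : Type u) [Group X] [Group Y] :
    WreathProduct X Y ⧸ (SemidirectProduct.rightHom (φ := wreathAut X Y)).ker ≃* Y :=
  QuotientGroup.quotientKerEquivOfSurjective _ SemidirectProduct.rightHom_surjective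

theorem wreath_of_ext_pi {C : ∀ (G : Type u) [Group G], Prop}
    (hiso : IsoClosed C) (he : ExtensionClosed C) (hp : PiClosed C) : WreathClosed C := by
  intro X Y _ _ hX hY
  refine he _ (SemidirectProduct.rightHom (φ := wreathAut X Y)).ker ?_
    (hiso _ _ (wrQuot X Y).symm hY)
  rw [← SemidirectProduct.range_inl_eq_ker_rightHom]
  exact hiso _ _ (MonoidHom.ofInjective SemidirectProduct.inl_injective) (hp X Y hX hY)

theorem wreath_of_gruenberg {C : ∀ (G : Type u) [Group G], Prop}
    (hiso : IsoClosed C) (hg : Gruenberg C) : WreathClosed C := by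
  intro X Y _ _ hX hY
  let B := (SemidirectProduct.rightHom (φ := wreathAut X Y)).ker
  have hB : ∀ w : B, w.1.right = 1 := fun w => w.2
  let ev : B →* X := MonoidHom.mk' (fun w => w.1.left 1) (by
    intro a b
    simp [hB a])
  have hev : Function.Surjective ev := fun x =>
    ⟨⟨SemidirectProduct.inl (fun _ => x), by simp [B]⟩, rfl⟩
  have e : (ev.ker.map B.subtype).subgroupOf B = ev.ker :=
    Subgroup.comap_map_eq_self_of_injective B.subtype_injective _
  have : ((ev.ker.map B.subtype).subgroupOf B).Normal := by rw [e]; infer_instance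
  obtain ⟨T, hT, hle, hC⟩ := hg (WreathProduct X Y) B (ev.ker.map B.subtype)
    (Subgroup.map_subtype_le _)
    (hiso _ _ ((QuotientGroup.quotientMulEquivOfEq e).trans
      (QuotientGroup.quotientKerEquivOfSurjective ev hev)).symm hX)
    (hiso _ _ (wrQuot X Y).symm hY)
  have key : ∀ w ∈ T, w.right = 1 ∧ w.left 1 = 1 := by
    intro w hw
    obtain ⟨b, hb, rfl⟩ := hle hw
    exact ⟨hB b, hb⟩
  have hT' : T = ⊥ := by
    rw [eq_bot_iff]
    intro w hw
    have hr := (key w hw).1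
    rw [Subgroup.mem_bot]
    refine SemidirectProduct.ext ?_ hr
    funext y
    have := (key _ (hT.conj_mem w hw (SemidirectProduct.inr (φ := wreathAut X Y) y⁻¹))).2
    change (1 * w.left (y⁻¹⁻¹ * 1)) * (1 : X)⁻¹ = 1 at this
    simpa using this
  subst hT'
  exact hiso _ _ QuotientGroup.quotientBot hC

theorem rootClass_characterization (C : ∀ (G : Type u) [Group G], Prop)
    (hiso : IsoClosed C) (hsub : SubgroupClosed C) :
    (Gruenberg C ↔ WreathClosed C) ∧
    (WreathClosed C ↔ (ExtensionClosed C ∧ PiClosed C)) := by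
  refine ⟨⟨wreath_of_gruenberg hiso, gruenberg_of_wreath hiso hsub⟩, fun hw => ⟨?_, ?_⟩,
    fun h => wreath_of_ext_pi hiso h.1 h.2⟩
  · exact ext_of_gruenberg hiso (gruenberg_of_wreath hiso hsub hw)
  · intro X Y _ _ hX hY
    exact C_of_inj hiso hsub (SemidirectProduct.inl (φ := wreathAut X Y))
      SemidirectProduct.inl_injective (hw X Y hX hY)
end

section
/- Let C be a class of groups closed under isomorphism and under taking subgroups, and suppose C satisfies the Gruenberg condition. Then for all groups X, Y in C, the complete (Cartesian) wreath product X Wr Y belongs to C. -/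
universe u

/-- If a class of groups closed under isomorphism and under taking subgroups satisfies
the Gruenberg condition, then it is closed under complete (Cartesian) wreath products. -/
theorem wreathClosed_of_gruenberg (C : ∀ (G : Type u) [Group G], Prop)
    (hiso : IsoClosed C) (hsub : SubgroupClosed C) (hgru : Gruenberg C) :
    WreathClosed C := by
  intro X Y _ _ hX hY
  let B : Subgroup (WreathProduct X Y) := (SemidirectProduct.rightHom).ker
  have hB : ∀ b : B, b.1.right = 1 := fun b => b.2
  let f : B →* X :=
    { toFun := fun b => b.1.left 1
      map_one' := rfl
      map_mul' := fun a b => by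
        simp [hB a] }
  let Z : Subgroup (WreathProduct X Y) := f.ker.map B.subtype
  have hZ : Z.subgroupOf B = f.ker :=
    Subgroup.comap_map_eq_self_of_injective B.subtype_injective _
  have hn : (Z.subgroupOf B).Normal := by rw [hZ]; infer_instance
  have hf : Function.Surjective f := fun x =>
    ⟨⟨SemidirectProduct.inl (fun _ => x), by simp [B, MonoidHom.mem_ker]⟩, rfl⟩
  have h1 : C (B ⧸ Z.subgroupOf B) :=
    hiso _ _ ((QuotientGroup.quotientMulEquivOfEq hZ).trans
      (QuotientGroup.quotientKerEquivOfSurjective f hf)).symm hX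
  have h2 : C (WreathProduct X Y ⧸ B) :=
    hiso _ _ (QuotientGroup.quotientKerEquivOfSurjective _
      SemidirectProduct.rightHom_surjective).symm hY
  have hle : Z ≤ B := Subgroup.map_subtype_le _
  obtain ⟨T, hT, hTZ, hC⟩ := hgru _ B Z hle h1 h2
  have key : ∀ t ∈ T, t.right = 1 ∧ t.left 1 = 1 := by
    intro t ht
    obtain ⟨b, hb, rfl⟩ := hTZ ht
    exact ⟨hB b, hb⟩
  have hbot : T = ⊥ := by
    rw [Subgroup.eq_bot_iff_forall]
    intro t ht
    refine SemidirectProduct.ext ?_ (key t ht).1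
    funext y
    have h := (key _ (hT.conj_mem t ht (SemidirectProduct.inr y⁻¹))).2
    have hw : ∀ (g : Y) (b : Y → X) (z : Y), (MulEquiv.symm (wreathAut X Y g)) b z = b (g * z) :=
      fun _ _ _ => rfl
    simpa [hw, (key t ht).1] using h
  subst hbot
  exact hiso _ _ QuotientGroup.quotientBot hC
end

section
/- Let C be a class of groups closed under isomorphism and under taking subgroups. Suppose C is closed under extensions and, for any two groups X, Y ∈ C, contains the unrestricted Cartesian product ∏_{y ∈ Y} X_y, where each X_y is an isomorphic copy of X. Then C satisfies the Gruenberg condition: for every group X and every subnormal chain Z ⊴ Y ⊴ X with Y/Z ∈ C and X/Y ∈ C, there exists a normal subgroup T of X with T ≤ Z and X/T ∈ C. -/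
universe u

/-- If a class of groups closed under isomorphism and under taking subgroups is closed
under extensions and under unrestricted Cartesian powers indexed by members of the class,
then it satisfies the Gruenberg condition. -/
theorem gruenberg_of_extension_and_pi_closed (C : ∀ (G : Type u) [Group G], Prop)
    (hiso : IsoClosed C) (hsub : SubgroupClosed C)
    (hext : ExtensionClosed C) (hpi : PiClosed C) :
    Gruenberg C := by
  intro X _ Y _ Z _ hZY hYZ hXY
  have hconj : ∀ (x : X) (y : Y), x⁻¹ * (y : X) * x ∈ Y := fun x y => by
    have := (inferInstance : Y.Normal).conj_mem y y.2 x⁻¹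
    simpa using this
  let φ : Y →* ((X ⧸ Y) → (Y ⧸ Z.subgroupOf Y)) :=
    { toFun := fun y q => QuotientGroup.mk (⟨(q.out)⁻¹ * (y : X) * q.out, hconj _ _⟩ : Y)
      map_one' := by
        funext q
        simp only [Pi.one_apply]
        rw [QuotientGroup.eq_one_iff, Subgroup.mem_subgroupOf]
        simp
      map_mul' := fun a b => by
        funext q
        simp only [Pi.mul_apply]
        rw [← QuotientGroup.mk_mul]
        congr 1
        ext
        simp [mul_assoc] }
  have hφ : ∀ y : Y, y ∈ φ.ker ↔ ∀ q : X ⧸ Y, (q.out)⁻¹ * (y : X) * q.out ∈ Z := fun y => by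
    rw [MonoidHom.mem_ker, funext_iff]
    refine forall_congr' fun q => ?_
    change (QuotientGroup.mk (⟨(q.out)⁻¹ * (y : X) * q.out, hconj _ _⟩ : Y) :
      Y ⧸ Z.subgroupOf Y) = 1 ↔ _
    rw [QuotientGroup.eq_one_iff, Subgroup.mem_subgroupOf]
  have hker : φ.ker = ((QuotientGroup.mk' Z.normalCore).comp Y.subtype).ker := by
    ext y
    rw [hφ, MonoidHom.mem_ker]
    have : ((QuotientGroup.mk' Z.normalCore).comp Y.subtype) y = 1 ↔
        (y : X) ∈ Z.normalCore := by
      simp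
    rw [this]
    constructor
    · intro h x
      have h1 := h (QuotientGroup.mk x⁻¹)
      obtain ⟨w, hw⟩ := QuotientGroup.mk_out_eq_mul Y x⁻¹
      rw [hw] at h1
      have h2 : (⟨_, hZY h1⟩ : Y) ∈ Z.subgroupOf Y := h1
      have h3 := (inferInstance : (Z.subgroupOf Y).Normal).conj_mem _ h2 w
      rw [Subgroup.mem_subgroupOf] at h3
      have e : x * (y : X) * x⁻¹ =
          (w : X) * ((x⁻¹ * (w : X))⁻¹ * (y : X) * (x⁻¹ * (w : X))) * (w : X)⁻¹ := by group
      rw [e]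
      simpa using h3
    · intro h q
      have := h (q.out)⁻¹
      simpa using this
  refine ⟨Z.normalCore, inferInstance, Z.normalCore_le, ?_⟩
  have hTY : Z.normalCore ≤ Y := Z.normalCore_le.trans hZY
  refine hext (X ⧸ Z.normalCore) (Y.map (QuotientGroup.mk' Z.normalCore)) ?_ ?_
  · have e1 := QuotientGroup.quotientKerEquivRange φ
    have e2 := QuotientGroup.quotientKerEquivRange
      ((QuotientGroup.mk' Z.normalCore).comp Y.subtype)
    have e3 := QuotientGroup.quotientMulEquivOfEq hker
    have hr : ((QuotientGroup.mk' Z.normalCore).comp Y.subtype).range =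
        Y.map (QuotientGroup.mk' Z.normalCore) := by
      rw [MonoidHom.range_comp, Subgroup.range_subtype]
    exact hiso _ _ ((e1.symm.trans e3).trans (e2.trans (MulEquiv.subgroupCongr hr)))
      (hsub _ φ.range (hpi _ _ hYZ hXY))
  · exact hiso _ _ (QuotientGroup.quotientQuotientEquivQuotient Z.normalCore Y hTY).symm hXY
end

section
/- Let C be a class of groups closed under isomorphism and under taking subgroups, and suppose C satisfies the Gruenberg condition. Then C is closed under direct products: for any two groups X, Y ∈ C, the direct product X × Y belongs to C. (Hence the second condition in the definition of a root class follows from the first and the third.) -/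
universe u

/-- If a class of groups closed under isomorphism and under taking subgroups satisfies
the Gruenberg condition, then it is closed under direct products of two of its members
(hence the second condition in the definition of a root class is redundant). -/
theorem prodClosed_of_gruenberg (C : ∀ (G : Type u) [Group G], Prop)
    (hiso : IsoClosed C) (hsub : SubgroupClosed C) (hgru : Gruenberg C) :
    ProdClosed C := by
  intro X Y _ _ hX hY
  let K : Subgroup (X × Y) := (MonoidHom.snd X Y).ker
  have e1 : X ≃* K :=
    { toFun := fun x => ⟨(x, 1), MonoidHom.mem_ker.mpr rfl⟩
      invFun := fun k => k.1.1
      left_inv := fun x => rfl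
      right_inv := by
        rintro ⟨⟨a, b⟩, h⟩
        have h' : b = 1 := h
        subst h'
        rfl
      map_mul' := fun a b => by
        apply Subtype.ext
        simp }
  have hb : (⊥ : Subgroup (X × Y)).subgroupOf K = ⊥ := Subgroup.bot_subgroupOf K
  have hn : ((⊥ : Subgroup (X × Y)).subgroupOf K).Normal := by
    rw [hb]; infer_instance
  have e2 : X ≃* K ⧸ (⊥ : Subgroup (X × Y)).subgroupOf K :=
    e1.trans (QuotientGroup.quotientBot.symm.trans (QuotientGroup.quotientMulEquivOfEq hb.symm))
  have e3 : (X × Y) ⧸ K ≃* Y :=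
    QuotientGroup.quotientKerEquivOfSurjective (MonoidHom.snd X Y) Prod.snd_surjective
  obtain ⟨T, hT, hle, hC⟩ := hgru (X × Y) K ⊥ bot_le (hiso _ _ e2 hX) (hiso _ _ e3.symm hY)
  obtain rfl : T = ⊥ := le_bot_iff.mp hle
  exact hiso _ _ QuotientGroup.quotientBot hC
end

section
/- Let C be a class of groups (closed under isomorphism) all of whose members are finite groups. Then C is a root class if and only if C is closed under taking subgroups and closed under extensions. -/
universe u

theorem pow_mem_class (C : ∀ (G : Type u) [Group G], Prop)
    (hiso : IsoClosed C) (hs : SubgroupClosed C) (hp : ProdClosed C)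
    (G : Type u) [Group G] (hG : C G) (ι : Type u) [Finite ι] : C (ι → G) := by
  induction ι using Finite.induction_empty_option with
  | of_equiv e h => 
    exact hiso _ _ (MulEquiv.arrowCongr e (MulEquiv.refl G)) h
  | h_empty =>
    have e : (⊥ : Subgroup G) ≃* (PEmpty.{u+1} → G) :=
      { toFun := fun _ => 1
        invFun := fun _ => 1
        left_inv := fun x => Subsingleton.elim _ _
        right_inv := fun x => Subsingleton.elim _ _
        map_mul' := fun _ _ => by simp }
    exact hiso _ _ e (hs G ⊥ hG)
  | @h_option α _ h =>
    have e : (G × (α → G)) ≃* (Option α → G) :=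
      { toFun := fun p o => o.elim p.1 p.2
        invFun := fun f => (f none, fun a => f (some a))
        left_inv := fun x => rfl
        right_inv := fun x => by funext o; cases o <;> rfl
        map_mul' := fun _ _ => by funext o; cases o <;> rfl }
    exact hiso _ _ e (hp _ _ hG h)

theorem prod_of_ext (C : ∀ (G : Type u) [Group G], Prop)
    (hiso : IsoClosed C) (he : ExtensionClosed C) : ProdClosed C := by
  intro X Y _ _ hX hY
  have hs : Function.Surjective (MonoidHom.snd X Y) := fun y => ⟨(1, y), rfl⟩
  have e : X ≃* (MonoidHom.snd X Y).ker :=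
    { toFun := fun x => ⟨(x, 1), rfl⟩
      invFun := fun p => p.1.1
      left_inv := fun x => rfl
      right_inv := fun p => by
        obtain ⟨⟨a, b⟩, h⟩ := p
        have h' : b = 1 := h
        subst h'
        rfl
      map_mul' := fun a b => by ext <;> simp }
  exact he _ (MonoidHom.snd X Y).ker (hiso _ _ e hX)
    (hiso _ _ (QuotientGroup.quotientKerEquivOfSurjective _ hs).symm hY)

theorem gruenberg_of_ext (C : ∀ (G : Type u) [Group G], Prop)
    (hiso : IsoClosed C) (hfin : ∀ (G : Type u) [Group G], C G → Finite G)
    (hs : SubgroupClosed C) (he : ExtensionClosed C) : Gruenberg C := by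
  intro X _ Y hY Z hZ hZY hYZ hXY
  have := hfin _ hXY
  have hpow := pow_mem_class C hiso hs (prod_of_ext C hiso he) _ hYZ (X ⧸ Y)
  let f : Y →* ((X ⧸ Y) → Y ⧸ Z.subgroupOf Y) :=
    { toFun := fun y q => QuotientGroup.mk (MulAut.conjNormal (q.out)⁻¹ y)
      map_one' := by funext q; simp
      map_mul' := fun a b => by funext q; simp }
  have hker : f.ker = Z.normalCore.subgroupOf Y := by
    ext y
    rw [MonoidHom.mem_ker, Subgroup.mem_subgroupOf]
    constructor
    · intro h x
      have h1 := congrFun h (QuotientGroup.mk x⁻¹)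
      have h2 : MulAut.conjNormal ((QuotientGroup.mk x⁻¹ : X ⧸ Y).out)⁻¹ y ∈ Z.subgroupOf Y :=
        (QuotientGroup.eq_one_iff _).1 h1
      obtain ⟨k, hk⟩ := QuotientGroup.mk_out_eq_mul Y x⁻¹
      rw [hk] at h2
      have h3 := hZ.conj_mem _ h2 k
      rw [Subgroup.mem_subgroupOf] at h3
      simpa [mul_assoc] using h3
    · intro h
      funext q
      refine (QuotientGroup.eq_one_iff _).2 ?_
      rw [Subgroup.mem_subgroupOf]
      simpa using h (q.out)⁻¹
  refine ⟨Z.normalCore, inferInstance, Z.normalCore_le, ?_⟩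
  show C (X ⧸ Z.normalCore)
  have hTY : Z.normalCore ≤ Y := Z.normalCore_le.trans hZY
  let g : Y →* X ⧸ Z.normalCore := (QuotientGroup.mk' Z.normalCore).comp Y.subtype
  have hg : g.ker = f.ker := by
    rw [hker]
    ext y
    rw [MonoidHom.mem_ker, Subgroup.mem_subgroupOf]
    exact QuotientGroup.eq_one_iff _
  have hr : g.range = Y.map (QuotientGroup.mk' Z.normalCore) := by
    rw [MonoidHom.range_comp, Subgroup.range_subtype]
  have e1 : f.range ≃* Y.map (QuotientGroup.mk' Z.normalCore) :=
    (QuotientGroup.quotientKerEquivRange f).symm.trans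
      ((QuotientGroup.quotientMulEquivOfEq hg.symm).trans
        ((QuotientGroup.quotientKerEquivRange g).trans (MulEquiv.subgroupCongr hr)))
  exact he _ (Y.map (QuotientGroup.mk' Z.normalCore)) (hiso _ _ e1 (hs _ _ hpow))
    (hiso _ _ (QuotientGroup.quotientQuotientEquivQuotient _ Y hTY).symm hXY)

/-- **Corollary 1.** A class of groups (closed under isomorphism) consisting only of
finite groups is a root class if and only if it is closed under taking subgroups and
under extensions. -/
theorem rootClass_iff_of_finite (C : ∀ (G : Type u) [Group G], Prop)
    (hiso : IsoClosed C) (hfin : ∀ (G : Type u) [Group G], C G → Finite G) :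
    RootClass C ↔ (SubgroupClosed C ∧ ExtensionClosed C) := by
  constructor
  · rintro ⟨-, hs, -, hg⟩
    refine ⟨hs, ?_⟩
    intro G _ N _ hN hQ
    have hb : (⊥ : Subgroup G).subgroupOf N = ⊥ := Subgroup.bot_subgroupOf N
    have : ((⊥ : Subgroup G).subgroupOf N).Normal := by rw [hb]; infer_instance
    obtain ⟨T, hT, hle, hC⟩ := hg G N ⊥ bot_le
      (hiso _ _ (QuotientGroup.quotientBot.symm.trans
        (QuotientGroup.quotientMulEquivOfEq hb.symm)) hN) hQ
    have hT' : T = ⊥ := le_bot_iff.1 hle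
    subst hT'
    exact hiso _ _ QuotientGroup.quotientBot hC
  · rintro ⟨hs, he⟩
    exact ⟨hiso, hs, prod_of_ext C hiso he, gruenberg_of_ext C hiso hfin hs he⟩
end

section
/- The intersection of any two root classes of groups is again a root class of groups. -/
universe u

theorem wreath_mul_left {A B : Type u} [Group A] [Group B] (a b : WreathProduct A B) (q : B) :
    (a * b).left q = a.left q * b.left (a.right⁻¹ * q) := rfl

theorem wreathClosed_of_rootClass (C : ∀ (G : Type u) [Group G], Prop)
    (hC : RootClass C) : WreathClosed C := by
  obtain ⟨hI, hS, hP, hG⟩ := hC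
  intro A B _ _ hA hB
  let W := WreathProduct A B
  let Y : Subgroup W := (SemidirectProduct.rightHom : W →* B).ker
  have hYmem : ∀ w : W, w ∈ Y ↔ w.right = 1 := fun w => MonoidHom.mem_ker
  let ev : Y →* A :=
    { toFun := fun w => w.1.left 1
      map_one' := rfl
      map_mul' := by
        intro a b
        have ha : a.1.right = 1 := (hYmem _).1 a.2
        refine (wreath_mul_left a.1 b.1 1).trans ?_
        rw [ha, inv_one, mul_one] }
  let Z : Subgroup W := ev.ker.map Y.subtype
  have hZY : Z.subgroupOf Y = ev.ker := by
    exact Subgroup.comap_map_eq_self_of_injective Y.subtype_injective _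
  have hZn : (Z.subgroupOf Y).Normal := by rw [hZY]; infer_instance
  have hev : Function.Surjective ev := by
    intro a
    refine ⟨⟨SemidirectProduct.inl (fun _ => a), (hYmem _).2 (by simp)⟩, ?_⟩
    simp [ev]
  have h1 : C (Y ⧸ Z.subgroupOf Y) :=
    hI _ _ ((QuotientGroup.quotientMulEquivOfEq hZY).trans
      (QuotientGroup.quotientKerEquivOfSurjective ev hev)).symm hA
  have h2 : C (W ⧸ Y) :=
    hI _ _ (QuotientGroup.quotientKerEquivOfSurjective _
      SemidirectProduct.rightHom_surjective).symm hB
  obtain ⟨T, hT, hTZ, hCT⟩ := hG W Y Z (Subgroup.map_subtype_le _) h1 h2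
  have key : ∀ t ∈ T, t.right = 1 ∧ t.left 1 = 1 := by
    intro t ht
    obtain ⟨y, hy, rfl⟩ := hTZ ht
    exact ⟨(hYmem _).1 y.2, hy⟩
  have hbot : T = ⊥ := by
    rw [eq_bot_iff]
    intro t ht
    rw [Subgroup.mem_bot]
    refine SemidirectProduct.ext ?_ (key t ht).1
    funext q
    have := (key _ (hT.conj_mem t ht (SemidirectProduct.inr q⁻¹))).2
    have h3 : (1 : A) * t.left ((q⁻¹)⁻¹ * 1) * (1 : A)⁻¹ = 1 := this
    simpa using h3
  subst hbot
  exact hI _ _ QuotientGroup.quotientBot hCT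

theorem exists_wreath_hom (X : Type u) [Group X] (Y : Subgroup X) [Y.Normal] (Z : Subgroup X)
    [(Z.subgroupOf Y).Normal] :
    ∃ φ : X →* WreathProduct (Y ⧸ Z.subgroupOf Y) (X ⧸ Y), φ.ker ≤ Z := by
  classical
  obtain ⟨s, hs, hs1⟩ : ∃ s : X ⧸ Y → X, (∀ q, (s q : X ⧸ Y) = q) ∧ s 1 = 1 := by
    refine ⟨fun q => if q = 1 then 1 else q.out, fun q => ?_, by simp⟩
    by_cases h : q = 1
    · simp [h]
    · simp [h]
  have hmem : ∀ (x : X) (q : X ⧸ Y), (s q)⁻¹ * x * s ((x : X ⧸ Y)⁻¹ * q) ∈ Y := by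
    intro x q
    rw [← QuotientGroup.eq_one_iff]
    simp [hs]
  let f : X → (X ⧸ Y) → Y := fun x q => ⟨_, hmem x q⟩
  have hf : ∀ x y q, f (x * y) q = f x q * f y ((x : X ⧸ Y)⁻¹ * q) := by
    intro x y q
    apply Subtype.ext
    simp [f, mul_assoc]
  let φ : X →* WreathProduct (Y ⧸ Z.subgroupOf Y) (X ⧸ Y) :=
    MonoidHom.mk' (fun x => ⟨fun q => (f x q : Y ⧸ Z.subgroupOf Y), (x : X ⧸ Y)⟩) (by
      intro x y
      refine SemidirectProduct.ext ?_ rfl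
      funext q
      refine Eq.trans ?_ (wreath_mul_left _ _ q).symm
      exact congrArg (QuotientGroup.mk (s := Z.subgroupOf Y)) (hf x y q))
  refine ⟨φ, fun x hx => ?_⟩
  have hx' : φ x = 1 := hx
  have hr : (x : X ⧸ Y) = 1 := congrArg SemidirectProduct.right hx'
  have hl : (f x 1 : Y ⧸ Z.subgroupOf Y) = 1 :=
    congrFun (congrArg SemidirectProduct.left hx') 1
  rw [QuotientGroup.eq_one_iff, Subgroup.mem_subgroupOf] at hl
  simpa [f, hr, hs1] using hl

/-- **Corollary 2.** The intersection of any two root classes of groups is again a root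
class of groups. -/
theorem rootClass_inter (C D : ∀ (G : Type u) [Group G], Prop)
    (hC : RootClass C) (hD : RootClass D) :
    RootClass (fun (G : Type u) [Group G] => C G ∧ D G) := by
  have wC := wreathClosed_of_rootClass C hC
  have wD := wreathClosed_of_rootClass D hD
  obtain ⟨hCI, hCS, hCP, -⟩ := hC
  obtain ⟨hDI, hDS, hDP, -⟩ := hD
  refine ⟨fun G H _ _ e h => ⟨hCI G H e h.1, hDI G H e h.2⟩,
    fun G _ H h => ⟨hCS G H h.1, hDS G H h.2⟩,
    fun X Y _ _ hX hY => ⟨hCP X Y hX.1 hY.1, hDP X Y hX.2 hY.2⟩, ?_⟩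
  intro X _ Y _ Z _ _ h1 h2
  obtain ⟨φ, hφ⟩ := exists_wreath_hom X Y Z
  exact ⟨φ.ker, inferInstance, hφ,
    hCI _ _ (QuotientGroup.quotientKerEquivRange φ).symm (hCS _ φ.range (wC _ _ h1.1 h2.1)),
    hDI _ _ (QuotientGroup.quotientKerEquivRange φ).symm (hDS _ φ.range (wD _ _ h1.2 h2.2))⟩
end

section
/- If C is a root class of groups, then the class C₀ consisting of all torsion-free groups belonging to C is also a root class of groups. -/
universe u

/-- **Corollary 3.** If `C` is a root class of groups, then the class of all torsion-free
`C`-groups is a root class too. -/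
theorem rootClass_torsionFree (C : ∀ (G : Type u) [Group G], Prop) (hC : RootClass C) :
    RootClass (fun (G : Type u) [Group G] =>
      C G ∧ ∀ g : G, IsOfFinOrder g → g = 1) := by
  obtain ⟨hI, hS, hP, hG⟩ := hC
  refine ⟨?_, ?_, ?_, ?_⟩
  · intro G H _ _ e ⟨h1, h2⟩
    refine ⟨hI G H e h1, fun g hg => ?_⟩
    have := h2 (e.symm g) (e.symm.toMonoidHom.isOfFinOrder hg)
    simpa using this
  · intro G _ H ⟨h1, h2⟩
    refine ⟨hS G H h1, fun g hg => ?_⟩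
    have := h2 (g : G) (H.subtype.isOfFinOrder hg)
    exact_mod_cast this
  · intro X Y _ _ ⟨h1, h2⟩ ⟨h3, h4⟩
    refine ⟨hP X Y h1 h3, fun g hg => ?_⟩
    exact Prod.ext (h2 _ ((MonoidHom.fst X Y).isOfFinOrder hg))
      (h4 _ ((MonoidHom.snd X Y).isOfFinOrder hg))
  · intro X _ Y _ Z _ hZY ⟨h1, h2⟩ ⟨h3, h4⟩
    refine ⟨Z.normalCore, inferInstance, Z.normalCore_le, ?_, ?_⟩
    · have hNZ := Z.normalCore_le
      have hNY := hNZ.trans hZY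
      let π := QuotientGroup.mk' Z.normalCore
      have hπ : Function.Surjective π := QuotientGroup.mk'_surjective _
      have hmem : ∀ x : X, π x ∈ Z.map π → x ∈ Z := by
        rintro x ⟨z, hz, hzx⟩
        have : z⁻¹ * x ∈ Z.normalCore := QuotientGroup.eq.1 hzx
        simpa using Z.mul_mem hz (hNZ this)
      let f := π.subgroupMap Y
      have hf : Function.Surjective f := π.subgroupMap_surjective Y
      haveI hYn : (Y.map π).Normal := Subgroup.Normal.map ‹_› π hπ
      have hEq : (Z.subgroupOf Y).map f = (Z.map π).subgroupOf (Y.map π) := by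
        ext w
        obtain ⟨y, rfl⟩ := hf w
        constructor
        · rintro ⟨z, hz, hzy⟩
          rw [← hzy]
          exact ⟨z, hz, rfl⟩
        · intro h
          exact ⟨y, hmem _ h, rfl⟩
      haveI hZn : ((Z.map π).subgroupOf (Y.map π)).Normal :=
        hEq ▸ Subgroup.Normal.map ‹_› f hf
      let φ := (QuotientGroup.mk' ((Z.map π).subgroupOf (Y.map π))).comp f
      have hφ : Function.Surjective φ := (QuotientGroup.mk'_surjective _).comp hf
      have hker : Z.subgroupOf Y = φ.ker := by
        ext y
        have : y ∈ φ.ker ↔ f y ∈ (Z.map π).subgroupOf (Y.map π) :=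
          QuotientGroup.eq_one_iff (f y)
        rw [this]
        exact ⟨fun h => ⟨y, h, rfl⟩, fun h => hmem _ h⟩
      have c1 := hI _ _ ((QuotientGroup.quotientMulEquivOfEq hker).trans
        (QuotientGroup.quotientKerEquivOfSurjective φ hφ)) h1
      have c2 := hI _ _ (QuotientGroup.quotientQuotientEquivQuotient Z.normalCore Y hNY).symm h3
      obtain ⟨T, hT, hTZ, hCT⟩ := hG _ (Y.map π) (Z.map π) (Subgroup.map_mono hZY) c1 c2
      have hbot : T = ⊥ := by
        rw [eq_bot_iff]
        intro t ht
        obtain ⟨x, rfl⟩ := hπ t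
        refine (QuotientGroup.eq_one_iff x).2 fun b => hmem _ (hTZ ?_)
        simpa using hT.conj_mem _ ht (π b)
      subst hbot
      exact hI _ _ QuotientGroup.quotientBot hCT
    · intro g hg
      obtain ⟨x, rfl⟩ := QuotientGroup.mk_surjective g
      obtain ⟨n, hn, hx⟩ := isOfFinOrder_iff_pow_eq_one.1 hg
      have hx' : x ^ n ∈ Z.normalCore := (QuotientGroup.eq_one_iff _).1 hx
      have hxY : x ∈ Y := by
        refine (QuotientGroup.eq_one_iff x).1 (h4 _ (isOfFinOrder_iff_pow_eq_one.2 ⟨n, hn, ?_⟩))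
        exact (QuotientGroup.eq_one_iff (x ^ n)).2 (hZY (Z.normalCore_le hx'))
      refine (QuotientGroup.eq_one_iff x).2 fun b => ?_
      have hbY : b * x * b⁻¹ ∈ Y := Subgroup.Normal.conj_mem ‹_› x hxY b
      refine (QuotientGroup.eq_one_iff (⟨_, hbY⟩ : Y)).1
        (h2 _ (isOfFinOrder_iff_pow_eq_one.2 ⟨n, hn, ?_⟩))
      refine (QuotientGroup.eq_one_iff ((⟨_, hbY⟩ : Y) ^ n)).2 ?_
      rw [Subgroup.mem_subgroupOf]
      have := hx' b
      simpa [conj_pow] using this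
end

section
/- Let C be a root class of groups that is closed under taking quotient groups, and let A and B be abelian C-groups with subgroups H ≤ A, K ≤ B amalgamated according to an isomorphism φ : H → K. Let G = ⟨A * B; H = K, φ⟩ be the corresponding generalized free product. Then the generalized direct product P = ⟨A × B; H = K, φ⟩, i.e., the quotient of the direct product A × B by the subgroup generated by {(h, φ(h)⁻¹) : h ∈ H}, belongs to C, and the natural homomorphism of G onto P (extending the inclusions of A and B) is injective on A and on B. -/
universe u

instance boolCondGroup {A B : Type u} [Group A] [Group B] : ∀ i : Bool, Group (cond i A B)
  | true => ‹Group A›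
  | false => ‹Group B›

/-- The two inclusions of the amalgamated subgroup, `H ↪ A` and `H ≃ K ↪ B`. -/
def amalgMaps {A B : Type u} [Group A] [Group B] (H : Subgroup A) (K : Subgroup B)
    (φ : H ≃* K) : ∀ i : Bool, (H : Type u) →* cond i A B
  | true => H.subtype
  | false => K.subtype.comp φ.toMonoidHom

/-- The generalized free product (amalgamated free product) `⟨A * B; H = K, φ⟩`,
realized as the pushout of the inclusions `H ↪ A` and `H → K ↪ B`. -/
def AmalgamatedProduct (A B : Type u) [Group A] [Group B] (H : Subgroup A) (K : Subgroup B)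
    (φ : H ≃* K) : Type u :=
  Monoid.PushoutI (amalgMaps H K φ)

instance (A B : Type u) [Group A] [Group B] (H : Subgroup A) (K : Subgroup B) (φ : H ≃* K) :
    Group (AmalgamatedProduct A B H K φ) := by
  delta AmalgamatedProduct; infer_instance

/-- The canonical homomorphism of `A` into the amalgamated product. -/
def amalgInl {A B : Type u} [Group A] [Group B] (H : Subgroup A) (K : Subgroup B)
    (φ : H ≃* K) : A →* AmalgamatedProduct A B H K φ :=
  Monoid.PushoutI.of (φ := amalgMaps H K φ) true

/-- The canonical homomorphism of `B` into the amalgamated product. -/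
def amalgInr {A B : Type u} [Group A] [Group B] (H : Subgroup A) (K : Subgroup B)
    (φ : H ≃* K) : B →* AmalgamatedProduct A B H K φ :=
  Monoid.PushoutI.of (φ := amalgMaps H K φ) false

/-- A class of groups `C` is closed under taking quotient groups. -/
def QuotClosed (C : ∀ (G : Type u) [Group G], Prop) : Prop :=
  ∀ (G : Type u) [Group G] (N : Subgroup G) [N.Normal], C G → C (G ⧸ N)

/-- Let `C` be a root class closed under quotients and let `A`, `B` be abelian
`C`-groups with subgroups `H ≤ A`, `K ≤ B` amalgamated according to `φ : H → K`. Then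
the generalized direct product `P = ⟨A × B; H = K, φ⟩`, i.e. the quotient of `A × B` by
the subgroup generated by `{(h, φ(h)⁻¹) : h ∈ H}`, belongs to `C`, and the natural
homomorphism of `G = ⟨A * B; H = K, φ⟩` onto `P` (extending the inclusions of `A` and
`B`) is injective on `A` and on `B`. -/
theorem generalized_direct_product_of_abelian (C : ∀ (G : Type u) [Group G], Prop)
    (hC : RootClass C) (hquot : QuotClosed C)
    (A B : Type u) [CommGroup A] [CommGroup B]
    (hCA : C A) (hCB : C B)
    (H : Subgroup A) (K : Subgroup B) (φ : H ≃* K) :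
    ∀ T : Subgroup (A × B),
      T = Subgroup.closure (Set.range fun h : H => (((h : A), ((φ h : K) : B)⁻¹) : A × B)) →
      C ((A × B) ⧸ T) ∧
      ∃ f : AmalgamatedProduct A B H K φ →* (A × B) ⧸ T,
        Function.Surjective f ∧
        (∀ a : A, f (amalgInl H K φ a) = QuotientGroup.mk (a, 1)) ∧
        (∀ b : B, f (amalgInr H K φ b) = QuotientGroup.mk (1, b)) ∧
        Function.Injective (f.comp (amalgInl H K φ)) ∧
        Function.Injective (f.comp (amalgInr H K φ)) := by
  intro T hT
  have hle : ∀ h : H, (((h : A), ((φ h : K) : B)⁻¹) : A × B) ∈ T := fun h => by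
    rw [hT]; exact Subgroup.subset_closure ⟨h, rfl⟩
  have hmem : ∀ x ∈ T, ∃ h : H, (((h : A), ((φ h : K) : B)⁻¹) : A × B) = x := by
    intro x hx
    rw [hT] at hx
    induction hx using Subgroup.closure_induction with
    | mem x hx => exact hx
    | one => exact ⟨1, by simp⟩
    | mul x y _ _ hx hy =>
      obtain ⟨h, rfl⟩ := hx
      obtain ⟨k, rfl⟩ := hy
      exact ⟨h * k, by simp [mul_comm]⟩
    | inv x _ hx =>
      obtain ⟨h, rfl⟩ := hx
      exact ⟨h⁻¹, by simp⟩
  refine ⟨hquot _ T (hC.2.2.1 A B hCA hCB), ?_⟩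
  let g : ∀ i : Bool, cond i A B →* (A × B) ⧸ T := fun i =>
    match i with
    | true => (QuotientGroup.mk' T).comp (MonoidHom.inl A B)
    | false => (QuotientGroup.mk' T).comp (MonoidHom.inr A B)
  let k : H →* (A × B) ⧸ T := ((QuotientGroup.mk' T).comp (MonoidHom.inl A B)).comp H.subtype
  have hk : ∀ i, (g i).comp (amalgMaps H K φ i) = k := by
    intro i
    cases i with
    | true => rfl
    | false =>
      ext h
      change (QuotientGroup.mk ((1 : A), ((φ h : K) : B)) : (A × B) ⧸ T)
        = QuotientGroup.mk ((h : A), (1 : B))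
      rw [QuotientGroup.eq]
      simpa using hle h
  let f : AmalgamatedProduct A B H K φ →* (A × B) ⧸ T :=
    Monoid.PushoutI.lift (φ := amalgMaps H K φ) g k hk
  have hf1 : ∀ a : A, f (amalgInl H K φ a) = QuotientGroup.mk (a, 1) := fun a =>
    Monoid.PushoutI.lift_of (φ := amalgMaps H K φ) (i := true) g k hk a
  have hf2 : ∀ b : B, f (amalgInr H K φ b) = QuotientGroup.mk (1, b) := fun b =>
    Monoid.PushoutI.lift_of (φ := amalgMaps H K φ) (i := false) g k hk b
  refine ⟨f, ?_, hf1, hf2, ?_, ?_⟩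
  · intro x
    obtain ⟨⟨a, b⟩, rfl⟩ := QuotientGroup.mk_surjective x
    refine ⟨amalgInl H K φ a * amalgInr H K φ b, ?_⟩
    rw [map_mul, hf1, hf2, ← QuotientGroup.mk_mul]
    simp
  · rw [injective_iff_map_eq_one]
    intro a ha
    rw [MonoidHom.comp_apply, hf1, QuotientGroup.eq_one_iff] at ha
    obtain ⟨h, hh⟩ := hmem _ ha
    simp only [Prod.mk.injEq] at hh
    obtain ⟨h1, h2⟩ := hh
    have : h = 1 := by simpa using h2
    rw [← h1, this]; rfl
  · rw [injective_iff_map_eq_one]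
    intro b hb
    rw [MonoidHom.comp_apply, hf2, QuotientGroup.eq_one_iff] at hb
    obtain ⟨h, hh⟩ := hmem _ hb
    simp only [Prod.mk.injEq] at hh
    obtain ⟨h1, h2⟩ := hh
    have : h = 1 := by simpa using h1
    rw [← h2, this]; simp
end

section
/- Let C be a nontrivial root class of groups that is closed under taking quotient groups. Then there exists a prime p such that C contains the cyclic group of order p, and consequently C contains every finite p-group. -/
universe u

theorem aux_surj (C : ∀ (G : Type u) [Group G], Prop) (hiso : IsoClosed C) (hquot : QuotClosed C)
    (G H : Type u) [Group G] [Group H] (f : G →* H) (hf : Function.Surjective f) (h : C G) : C H :=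
  hiso _ _ (QuotientGroup.quotientKerEquivOfSurjective f hf) (hquot G f.ker h)

theorem aux_ext (C : ∀ (G : Type u) [Group G], Prop) (hiso : IsoClosed C) (hgr : Gruenberg C)
    (G : Type u) [Group G] (N : Subgroup G) [N.Normal] (hN : C N) (hq : C (G ⧸ N)) : C G := by
  have e : (⊥ : Subgroup G).subgroupOf N = ⊥ := Subgroup.bot_subgroupOf N
  have : ((⊥ : Subgroup G).subgroupOf N).Normal := by rw [e]; infer_instance
  have h1 : C (N ⧸ (⊥ : Subgroup G).subgroupOf N) :=
    hiso _ _ ((QuotientGroup.quotientBot (G := N)).symm.trans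
      (QuotientGroup.quotientMulEquivOfEq e.symm)) hN
  obtain ⟨T, hT, hle, hc⟩ := hgr G N ⊥ bot_le h1 hq
  have hT' : T = ⊥ := le_bot_iff.mp hle
  subst hT'
  exact hiso _ _ (QuotientGroup.quotientBot (G := G)) hc

theorem aux_cyc (C : ∀ (G : Type u) [Group G], Prop) (hC : RootClass C) (hquot : QuotClosed C)
    (G : Type u) [Group G] [Nontrivial G] (hG : C G) :
    ∃ p : ℕ, p.Prime ∧ ∃ (H : Type u) (hH : Group H), letI := hH;
        (IsCyclic H ∧ Nat.card H = p ∧ C H) := by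
  obtain ⟨hiso, hsub, -, -⟩ := hC
  obtain ⟨g, hg⟩ := exists_ne (1 : G)
  by_cases h0 : orderOf g = 0
  · refine ⟨2, Nat.prime_two, ULift.{u} (Multiplicative (ZMod 2)), inferInstance, ?_, ?_, ?_⟩
    · exact isCyclic_of_surjective (MulEquiv.ulift.{0,u} (α := Multiplicative (ZMod 2))).symm
        (MulEquiv.surjective _)
    · rw [Nat.card_congr Equiv.ulift, Nat.card_congr Multiplicative.toAdd, Nat.card_zmod]
    · have hz : Function.Injective (zpowersHom G g) := by
        intro a b hab
        have hi := (injective_zpow_iff_not_isOfFinOrder (x := g)).2 (orderOf_eq_zero_iff.1 h0)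
        rw [zpowersHom_apply, zpowersHom_apply] at hab
        exact Multiplicative.toAdd.injective (hi hab)
      have e1 : Multiplicative ℤ ≃* (zpowersHom G g).range := MonoidHom.ofInjective hz
      let f : Multiplicative ℤ →* Multiplicative (ZMod 2) :=
        AddMonoidHom.toMultiplicative (Int.castAddHom (ZMod 2))
      have hf : Function.Surjective f := fun x => by
        obtain ⟨n, hn⟩ := ZMod.intCast_surjective (Multiplicative.toAdd x)
        exact ⟨Multiplicative.ofAdd n, congrArg Multiplicative.ofAdd hn⟩
      refine aux_surj C hiso hquot _ _ (((MulEquiv.ulift.{0,u}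
        (α := Multiplicative (ZMod 2))).symm.toMonoidHom.comp f).comp e1.symm.toMonoidHom) ?_
        (hsub G _ hG)
      exact ((MulEquiv.surjective (MulEquiv.ulift.{0,u}
        (α := Multiplicative (ZMod 2))).symm).comp hf).comp e1.symm.surjective
  · have h1 : orderOf g ≠ 1 := fun h => hg (orderOf_eq_one_iff.1 h)
    refine ⟨(orderOf g).minFac, Nat.minFac_prime h1,
      Subgroup.zpowers (g ^ (orderOf g / (orderOf g).minFac)), inferInstance, inferInstance, ?_,
      hsub _ _ hG⟩
    rw [Nat.card_zpowers, orderOf_pow_orderOf_div h0 (Nat.minFac_dvd _)]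

theorem aux_pgroup (C : ∀ (G : Type u) [Group G], Prop) (hC : RootClass C)
    (p : ℕ) (hp : p.Prime) (H : Type u) [Group H] [IsCyclic H] (hH : Nat.card H = p) (hCH : C H)
    (n : ℕ) : ∀ (P : Type u) [Group P], Finite P → IsPGroup p P → Nat.card P = n → C P := by
  obtain ⟨hiso, hsub, -, hgr⟩ := hC
  have : Fact p.Prime := ⟨hp⟩
  induction n using Nat.strong_induction_on with
  | _ n ih =>
    intro P _ _ hP hn
    rcases subsingleton_or_nontrivial P with hs | hs
    · haveI : Unique P := uniqueOfSubsingleton 1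
      exact hiso (⊥ : Subgroup H) P MulEquiv.ofUnique (hsub H ⊥ hCH)
    · have := hP.center_nontrivial
      obtain ⟨k, hk, hck⟩ := (hP.to_subgroup (Subgroup.center P)).nontrivial_iff_card.1 this
      obtain ⟨z, hz⟩ := exists_prime_orderOf_dvd_card' (G := Subgroup.center P) p
        (by rw [hck]; exact dvd_pow_self p hk.ne')
      have hzo : orderOf (z : P) = p := by rw [Subgroup.orderOf_coe, hz]
      have hcard : Nat.card (Subgroup.zpowers (z : P)) = p := by rw [Nat.card_zpowers, hzo]
      have : (Subgroup.zpowers (z : P)).Normal := by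
        refine ⟨fun a ha b => ?_⟩
        have hb := Subgroup.mem_center_iff.1 (Subgroup.zpowers_le.2 z.2 ha) b
        rw [hb, mul_inv_cancel_right]
        exact ha
      refine aux_ext C hiso hgr P (Subgroup.zpowers (z : P)) ?_ ?_
      · exact hiso _ _ (mulEquivOfCyclicCardEq (hH.trans hcard.symm)) hCH
      · refine ih _ ?_ _ inferInstance (hP.to_quotient _) rfl
        have h2 := Subgroup.card_eq_card_quotient_mul_card_subgroup (Subgroup.zpowers (z : P))
        rw [hcard, hn] at h2
        have h3 : 0 < Nat.card (P ⧸ Subgroup.zpowers (z : P)) := Nat.card_pos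
        rw [h2]
        exact (Nat.lt_mul_iff_one_lt_right h3).2 hp.one_lt

/-- If `C` is a nontrivial root class of groups closed under taking quotient groups,
then there is a prime `p` such that `C` contains the cyclic group of order `p`, and
consequently `C` contains every finite `p`-group. -/
theorem exists_prime_cyclic_and_pGroups_mem (C : ∀ (G : Type u) [Group G], Prop)
    (hC : RootClass C) (hquot : QuotClosed C)
    (hnontriv : ∃ (G : Type u) (hG : Group G), letI := hG; (C G ∧ Nontrivial G)) :
    ∃ p : ℕ, p.Prime ∧
      (∃ (G : Type u) (hG : Group G), letI := hG;
        (IsCyclic G ∧ Nat.card G = p ∧ C G)) ∧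
      (∀ (P : Type u) [Group P], Finite P → IsPGroup p P → C P) := by
  obtain ⟨G, hG, hCG, hnt⟩ := hnontriv
  obtain ⟨p, hp, H, hH, hcyc, hcard, hCH⟩ := aux_cyc C hC hquot G hCG
  exact ⟨p, hp, ⟨H, hH, hcyc, hcard, hCH⟩, fun P _ hf hP =>
    aux_pgroup C hC p hp H hcard hCH _ P hf hP rfl⟩
end
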